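/- There is no number field K, Galois over ℚ with Galois group cyclic of order 8, in which the prime 2 is inert, i.e. such that 2·𝒪_K is a prime ideal of the ring of integers 𝒪_K. -/

import Mathlib

set_option linter.unusedSectionVars false

section Tame
variable {S G : Type*} [CommRing S] [IsDedekindDomain S] [Group G] [MulSemiringAction G S]

lemma gw_smul_mem_pow {P : Ideal S} {τ : G} (hτ : ∀ x, τ • x - x ∈ P) (n : ℕ) :
    ∀ x ∈ P ^ n, τ • x ∈ P ^ n := by
  induction n with
  | zero => intro x _; simp
  | succ n ih =>
    intro x hx
    rw [pow_succ] at hx ⊢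
    induction hx using Submodule.mul_induction_on' with
    | mem_mul_mem y hy z hz =>
      rw [smul_mul']
      refine Ideal.mul_mem_mul (ih y hy) ?_
      have := P.add_mem (hτ z) hz
      simpa using this
    | add y _ z _ h1 h2 =>
      rw [smul_add]
      exact Ideal.add_mem _ h1 h2

lemma gw_tame_mul {P : Ideal S} {τ ρ : G} (hτ : ∀ x, τ • x - x ∈ P) {π a b : S} (hπ : π ∈ P)
    (h1 : τ • π - a * π ∈ P ^ 2) (h2 : ρ • π - b * π ∈ P ^ 2) :
    (τ * ρ) • π - (a * b) * π ∈ P ^ 2 := by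
  have h3 := gw_smul_mem_pow hτ 2 _ h2
  rw [smul_sub, smul_mul', smul_smul] at h3
  have h4 : (τ • b - b) * π ∈ P ^ 2 := by
    rw [pow_two]; exact Ideal.mul_mem_mul (hτ b) hπ
  have h5 := (P ^ 2).mul_mem_left (τ • b) h1
  have h6 := (P ^ 2).mul_mem_left a h4
  convert! (P ^ 2).add_mem (Ideal.add_mem _ h3 h5) h6 using 1
  ring

lemma gw_tame_pow {P : Ideal S} {τ : G} (hτ : ∀ x, τ • x - x ∈ P) {π a : S} (hπ : π ∈ P)
    (h1 : τ • π - a * π ∈ P ^ 2) (k : ℕ) :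
    (τ ^ k) • π - (a ^ k) * π ∈ P ^ 2 := by
  induction k with
  | zero => simp
  | succ k ih =>
    rw [pow_succ' τ, pow_succ' a]
    exact gw_tame_mul hτ hπ h1 ih

lemma gw_graded {P : Ideal S} [P.IsPrime] (hP : P ≠ ⊥) {τ : G} (hτ : ∀ x, τ • x - x ∈ P) {π a : S}
    (hπ : π ∈ P) (hπ2 : π ∉ P ^ 2)
    (h1 : τ • π - a * π ∈ P ^ 2) (n : ℕ) :
    ∀ x ∈ P ^ n, τ • x - a ^ n * x ∈ P ^ (n + 1) := by
  have base : ∀ x ∈ P, τ • x - a * x ∈ P ^ 2 := by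
    intro x hx
    obtain ⟨d, e, he, rfl⟩ := Ideal.exists_mul_add_mem_pow_succ (i := 1) hP π x (by simpa using hπ)
      (by simpa using hπ2) (by simpa using hx)
    have h2 : e ∈ P ^ 2 := he
    have h3 := gw_smul_mem_pow hτ 2 _ h2
    have h4 : (τ • d - d) * π ∈ P ^ 2 := by
      rw [pow_two]; exact Ideal.mul_mem_mul (hτ d) hπ
    have h5 := (P ^ 2).mul_mem_left (τ • d) h1
    have h6 := (P ^ 2).mul_mem_left a h4
    have h7 := (P ^ 2).mul_mem_left a h2
    rw [smul_add, smul_mul']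
    convert! (P ^ 2).sub_mem (Ideal.add_mem _ (Ideal.add_mem _ h3 h5) h6) h7 using 1
    ring
  induction n with
  | zero => intro x _; simpa using hτ x
  | succ n ih =>
    intro x hx
    rw [pow_succ] at hx
    induction hx using Submodule.mul_induction_on' with
    | mem_mul_mem y hy z hz =>
      rw [smul_mul']
      have e2 := base z hz
      have e1 := ih y hy
      have hy' := gw_smul_mem_pow hτ n y hy
      have t1 : (τ • y) * (τ • z - a * z) ∈ P ^ (n + 1 + 1) := by
        rw [show n + 1 + 1 = n + 2 from rfl, pow_add]
        exact Ideal.mul_mem_mul hy' e2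
      have t2 : (τ • y - a ^ n * y) * (z) ∈ P ^ (n + 1 + 1) := by
        rw [pow_succ P (n+1)]
        exact Ideal.mul_mem_mul e1 hz
      convert! Ideal.add_mem _ t1 (Ideal.mul_mem_left _ a t2) using 1
      ring
    | add y _ z _ h1 h2 =>
      rw [smul_add]
      convert! Ideal.add_mem _ h1 h2 using 1
      ring

lemma gw_exists_val {P : Ideal S} [P.IsPrime] {z : S} (hz : z ≠ 0) :
    ∃ n, z ∈ P ^ n ∧ z ∉ P ^ (n + 1) := by
  by_contra! h
  apply hz
  have : z ∈ ⨅ i : ℕ, P ^ i := by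
    rw [Ideal.mem_iInf]
    intro n
    induction n with
    | zero => simp
    | succ n ih => exact h n ih
  rwa [Ideal.iInf_pow_eq_bot_of_isDomain P ‹P.IsPrime›.ne_top] at this

lemma gw_no_wild {P : Ideal S} [P.IsPrime] (hP : P ≠ ⊥) (h2 : (2 : S) ∉ P) {ρ : G}
    (hρ : ∀ x, ρ • x - x ∈ P) {π : S}
    (hπ : π ∈ P) (hπ2 : π ∉ P ^ 2) (h1 : ρ • π - π ∈ P ^ 2) (hsq : ρ * ρ = 1) (x : S) :
    ρ • x = x := by
  by_contra hx
  have hz : ρ • x - x ≠ 0 := sub_ne_zero.mpr hx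
  obtain ⟨n, hn, hn'⟩ := gw_exists_val (P := P) hz
  have := gw_graded hP hρ (a := 1) hπ hπ2 (by simpa using h1) n _ hn
  rw [smul_sub, smul_smul, hsq] at this
  refine h2 (Ideal.mem_prime_of_mul_mem_pow hP hn' ?_)
  convert! Ideal.neg_mem_iff _ |>.mpr this using 1
  simp
  ring

/-- the main local computation -/
lemma gw_local [FaithfulSMul G S] {P : Ideal S} [P.IsPrime] (hP : P ≠ ⊥) (h2 : (2 : S) ∉ P) {τ : G}
    (hτ : ∀ x, τ • x - x ∈ P) {m : ℕ} (hm : m ≠ 0) (hord : orderOf τ = 2 * m) {s : S}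
    (hs : s ∈ P ^ m) (hs' : s ∉ P ^ (m + 1)) :
    τ • s ≠ s ∧ ∃ a : S, a ^ m + 1 ∈ P := by
  obtain ⟨π, hπ, hπ2⟩ := Ideal.exists_mem_pow_notMem_pow_succ P hP ‹P.IsPrime›.ne_top 1
  rw [pow_one] at hπ
  have hτπ : τ • π ∈ P ^ 1 := gw_smul_mem_pow hτ 1 π (by simpa using hπ)
  obtain ⟨a, e, he, hae⟩ := Ideal.exists_mul_add_mem_pow_succ (i := 1) hP π (τ • π)
    (by simpa using hπ) hπ2 hτπ
  have h1 : τ • π - a * π ∈ P ^ 2 := by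
    rw [← hae]; convert! he using 1; ring
  have hτm : ∀ x, τ ^ m • x - x ∈ P := by
    have : τ ∈ P.inertia G := hτ
    exact pow_mem this m
  have ha2 : a ^ (2 * m) - 1 ∈ P := by
    have := gw_tame_pow hτ hπ h1 (2 * m)
    rw [← hord, pow_orderOf_eq_one, one_smul] at this
    refine Ideal.mem_prime_of_mul_mem_pow (i := 1) hP hπ2 ?_
    convert! Ideal.neg_mem_iff _ |>.mpr this using 1
    rw [hord]
    ring
  have ha : a ^ m + 1 ∈ P := by
    have : (a ^ m - 1) * (a ^ m + 1) ∈ P := by convert! ha2 using 1; ring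
    refine (Ideal.IsPrime.mem_or_mem ‹_› this).resolve_left fun h => ?_
    have h3 := gw_tame_pow hτ hπ h1 m
    have h4 : (a ^ m - 1) * π ∈ P ^ 2 := by
      rw [pow_two]; exact Ideal.mul_mem_mul h hπ
    have h5 : τ ^ m • π - π ∈ P ^ 2 := by
      convert! Ideal.add_mem _ h3 h4 using 1; ring
    have h6 : τ ^ m = 1 := by
      apply FaithfulSMul.eq_of_smul_eq_smul (α := S)
      intro x
      rw [one_smul]
      exact gw_no_wild hP h2 hτm hπ hπ2 h5
        (by rw [← pow_add, ← two_mul, ← hord, pow_orderOf_eq_one]) x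
    have := Nat.le_of_dvd (by omega) (orderOf_dvd_of_pow_eq_one h6)
    omega
  refine ⟨fun h => ?_, a, ha⟩
  have h3 := gw_graded hP hτ hπ hπ2 h1 m s hs
  rw [h] at h3
  have h4 : s * (a ^ m + 1) ∈ P ^ (m + 1) := by
    rw [pow_succ]; exact Ideal.mul_mem_mul hs ha
  refine h2 (Ideal.mem_prime_of_mul_mem_pow hP hs' ?_)
  convert! Ideal.add_mem _ h3 h4 using 1
  ring

end Tame

open NumberField

lemma gw_prime_mod (K : Type*) [Field K] [NumberField K]
    [IsGalois ℚ K] (σ : K ≃ₐ[ℚ] K) (hσ : ∀ g : K ≃ₐ[ℚ] K, g ∈ Subgroup.zpowers σ)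
    (hcard : Nat.card (K ≃ₐ[ℚ] K) = 8)
    (s : 𝓞 K) (hs : σ • s = -s) (d : ℤ) (hd : s ^ 2 = (d : 𝓞 K)) (hsf : Squarefree d)
    (p : ℕ) (hp : p.Prime) (hp2 : p ≠ 2) (hpd : (p : ℤ) ∣ d) : p % 8 = 1 := by
  have hpI : Prime (p : ℤ) := Nat.prime_iff_prime_int.mp hp
  have hp0 : (p : ℤ) ≠ 0 := hpI.ne_zero
  have : Fact p.Prime := ⟨hp⟩
  set pI : Ideal ℤ := Ideal.span {(p : ℤ)} with hpI_def
  have hpIprime : pI.IsPrime := (Ideal.span_singleton_prime hp0).mpr hpI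
  have hpIbot : pI ≠ ⊥ := by simpa [pI] using hp.ne_zero
  obtain ⟨⟨P, hPp, hPo⟩⟩ := (inferInstance : Nonempty (Ideal.primesOver pI (𝓞 K)))
  have hPbot : P ≠ ⊥ := Ideal.ne_bot_of_liesOver_of_ne_bot hpIbot P
  have hmem : ∀ n : ℤ, (n : 𝓞 K) ∈ P ↔ (p : ℤ) ∣ n := by
    intro n
    rw [← Ideal.mem_span_singleton, ← hpI_def, hPo.over, Ideal.mem_comap]
    simp
  have h2 : (2 : 𝓞 K) ∉ P := by
    have := (hmem 2).not.mpr (by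
      intro h
      have : p ∣ 2 := by exact_mod_cast h
      exact hp2 ((Nat.prime_dvd_prime_iff_eq hp Nat.prime_two).mp this))
    simpa using this
  obtain ⟨d', rfl⟩ := hpd
  have hd' : (d' : 𝓞 K) ∉ P := by
    rw [hmem]
    rintro ⟨c, rfl⟩
    exact hpI.not_isUnit (hsf p ⟨c, by ring⟩)
  have hs0 : s ≠ 0 := by
    rintro rfl
    apply hsf.ne_zero
    have : ((p * d' : ℤ) : 𝓞 K) = 0 := by rw [← hd]; simp
    exact_mod_cast this
  obtain ⟨m, hm1, hm2⟩ := gw_exists_val (P := P) hs0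
  have hs2 : s ^ 2 ∈ P ^ (2 * m) := by
    rw [mul_comm, pow_mul]; exact Ideal.pow_mem_pow hm1 2
  have hs3 : s ^ 2 ∉ P ^ (2 * m + 1) := by
    have hPprime := Ideal.prime_of_isPrime hPbot hPp
    have h1 : emultiplicity P (Ideal.span {s}) = m := by
      rw [emultiplicity_eq_coe]
      simp only [Ideal.dvd_iff_le, Ideal.span_singleton_le_iff_mem]
      exact ⟨hm1, hm2⟩
    have h2 := emultiplicity_pow hPprime (k := 2) (a := Ideal.span {s})
    rw [h1, Ideal.span_singleton_pow] at h2
    have h3 : emultiplicity P (Ideal.span {s ^ 2}) = ((2 * m : ℕ) : ℕ∞) := by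
      rw [h2]; push_cast; rfl
    rw [emultiplicity_eq_coe] at h3
    simpa only [Ideal.dvd_iff_le, Ideal.span_singleton_le_iff_mem] using h3.2
  have hle : Ideal.map (algebraMap ℤ (𝓞 K)) pI ≤ P ^ (2 * m) := by
    have hPprime := Ideal.prime_of_isPrime hPbot hPp
    rw [Ideal.map_span, Set.image_singleton, ← Ideal.dvd_iff_le]
    apply hPprime.pow_dvd_of_dvd_mul_right (b := Ideal.span {(d' : 𝓞 K)})
    · rwa [Ideal.dvd_iff_le, Ideal.span_singleton_le_iff_mem]
    · rw [Ideal.span_singleton_mul_span_singleton, Ideal.dvd_iff_le,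
        Ideal.span_singleton_le_iff_mem]
      rw [hd] at hs2
      simpa using hs2
  have hnle : ¬ Ideal.map (algebraMap ℤ (𝓞 K)) pI ≤ P ^ (2 * m + 1) := by
    intro h
    apply hs3
    rw [hd]
    push_cast
    apply Ideal.mul_mem_right
    apply h
    have := Ideal.mem_map_of_mem (algebraMap ℤ (𝓞 K)) (Ideal.mem_span_singleton_self (p : ℤ))
    simpa using this
  have hram : Nat.card (P.inertia (K ≃ₐ[ℚ] K)) = 2 * m := by
    rw [Ideal.card_inertia_eq_ramificationIdxIn (G := K ≃ₐ[ℚ] K) pI P,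
      Ideal.ramificationIdxIn_eq_ramificationIdx pI P (K ≃ₐ[ℚ] K),
      ← Ideal.ramificationIdx'_eq_ramificationIdx pI P hpIbot]
    exact Ideal.ramificationIdx'_spec hle hnle
  have hm : m ≠ 0 := by
    rintro rfl
    have := Nat.card_pos (α := P.inertia (K ≃ₐ[ℚ] K))
    omega
  have hcyc : IsCyclic (K ≃ₐ[ℚ] K) := ⟨σ, hσ⟩
  obtain ⟨⟨τ, hτ⟩, hτg⟩ := IsCyclic.exists_generator (α := P.inertia (K ≃ₐ[ℚ] K))
  have hord : orderOf τ = 2 * m := by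
    rw [← hram, ← orderOf_eq_card_of_forall_mem_zpowers hτg, Subgroup.orderOf_mk]
  have : FaithfulSMul (K ≃ₐ[ℚ] K) (𝓞 K) := IsGaloisGroup.faithful ℤ
  obtain ⟨hne, a, ha⟩ := gw_local (G := K ≃ₐ[ℚ] K) hPbot h2 hτ hm hord hm1 hm2
  have hσ8 : orderOf σ = 8 := by
    rw [← hcard]; exact orderOf_eq_card_of_forall_mem_zpowers hσ
  have hm4 : m = 4 := by
    obtain ⟨k, rfl⟩ := (mem_powers_iff_mem_zpowers (x := σ) (y := τ)).mpr (hσ τ)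
    have hk : Odd k := by
      rw [← Nat.not_even_iff_odd]
      rintro ⟨j, rfl⟩
      apply hne
      have : ∀ j : ℕ, (σ ^ (j + j)) • s = s := by
        intro j
        induction j with
        | zero => simp
        | succ j ih => 
          rw [show j + 1 + (j + 1) = j + j + 1 + 1 by ring, pow_succ, pow_succ, mul_smul, mul_smul,
            hs, smul_neg, hs, neg_neg, ih]
      exact this j
    have : orderOf (σ ^ k) = 8 := by
      rw [Nat.Coprime.orderOf_pow, hσ8]
      rw [hσ8]
      exact (Nat.coprime_pow_left_iff (n := 3) (by norm_num) 2 k).mpr (Nat.coprime_two_left.mpr hk)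
    simp only at hord
    omega
  subst hm4
  have hf := Ideal.ncard_primesOver_mul_card_inertia_mul_finrank (G := K ≃ₐ[ℚ] K) pI P
  rw [hram, hcard] at hf
  have hf1 : P.inertiaDeg ℤ = 1 := by
    have : P.inertiaDeg ℤ * (pI.primesOver (𝓞 K)).ncard = 1 := by nlinarith
    exact Nat.eq_one_of_mul_eq_one_right this
  have hPm : P.IsMaximal := hPp.isMaximal hPbot
  have hcardq : Nat.card (𝓞 K ⧸ P) = p := by
    have := Ideal.absNorm_eq_pow_inertiaDeg' P hp
    have hmax : (Ideal.span {(p : ℤ)}).IsMaximal := hpIprime.isMaximal hpIbot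
    rw [Ideal.inertiaDeg'_eq_inertiaDeg, hf1, pow_one] at this
    exact this
  let _ := Ideal.Quotient.field P
  have hfin : Finite (𝓞 K ⧸ P) := Nat.finite_of_card_ne_zero (by rw [hcardq]; exact hp.ne_zero)
  let _ := Fintype.ofFinite (𝓞 K ⧸ P)
  have ha1 : (Ideal.Quotient.mk P a) ^ 4 = -1 := by
    rw [eq_neg_iff_add_eq_zero, ← map_pow, ← map_one (Ideal.Quotient.mk P), ← map_add]
    exact Ideal.Quotient.eq_zero_iff_mem.mpr ha
  have h2' : (2 : 𝓞 K ⧸ P) ≠ 0 := by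
    intro h
    exact h2 (Ideal.Quotient.eq_zero_iff_mem.mp (by rw [map_ofNat]; exact h))
  have ho : orderOf (Ideal.Quotient.mk P a) = 2 ^ (2 + 1) := by
    apply orderOf_eq_prime_pow
    · norm_num
      rw [ha1]
      intro h
      apply h2'
      linear_combination -h
    · rw [pow_succ, pow_mul]
      rw [show 2 ^ 2 = 4 by norm_num, ha1]; ring
  have ha0 : Ideal.Quotient.mk P a ≠ 0 := by
    intro h; rw [h] at ha1; norm_num at ha1
  have hdvd : 8 ∣ p - 1 := by
    have := orderOf_dvd_of_pow_eq_one (FiniteField.pow_card_sub_one_eq_one _ ha0)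
    rw [ho, ← Nat.card_eq_fintype_card, hcardq] at this
    exact this
  have := hp.one_lt
  omega

lemma gw_two (K : Type*) [Field K] [NumberField K] (σ : K ≃ₐ[ℚ] K)
    (hinert : (Ideal.span {(2 : NumberField.RingOfIntegers K)}).IsPrime)
    (s : 𝓞 K) (hs : σ • s = -s) (d : ℤ) (hd : s ^ 2 = (d : 𝓞 K)) (hsf : Squarefree d) :
    d % 8 = 5 := by
  have hintegral : ∀ a b : ℤ, a ≠ 0 → (a : 𝓞 K) ∣ (b : 𝓞 K) → a ∣ b := by
    intro a b ha h
    have hn : (a : K) ≠ 0 := by exact_mod_cast ha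
    obtain ⟨c, hc⟩ := h
    have h1 : IsIntegral ℤ ((b : ℚ) / a) := by
      have h2 : IsIntegral ℤ (algebraMap ℚ K ((b : ℚ) / a)) := by
        have : algebraMap ℚ K ((b : ℚ) / a) = (c : K) := by
          have h3 := congrArg (fun x : 𝓞 K => (x : K)) hc
          simp only [map_intCast, map_mul] at h3
          rw [map_div₀, map_intCast, map_intCast, div_eq_iff hn, h3, mul_comm]
        rw [this]
        exact RingOfIntegers.isIntegral_coe c
      exact (isIntegral_algebraMap_iff (algebraMap ℚ K).injective).mp h2
    obtain ⟨z, hz⟩ := IsIntegrallyClosed.isIntegral_iff.mp h1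
    refine ⟨z, ?_⟩
    have ha' : (a : ℚ) ≠ 0 := by exact_mod_cast ha
    rw [eq_div_iff ha'] at hz
    have : z * a = b := by
      rw [eq_intCast] at hz
      exact_mod_cast hz
    rw [← this, mul_comm]
  have hmem : ∀ x : 𝓞 K, x ∈ Ideal.span {(2 : 𝓞 K)} ↔ 2 ∣ x := fun x =>
    Ideal.mem_span_singleton
  have hodd : ¬ (2 ∣ d) := by
    rintro ⟨k, rfl⟩
    have h1 : s ^ 2 ∈ Ideal.span {(2 : 𝓞 K)} := by
      rw [hmem, hd]; push_cast; exact dvd_mul_right _ _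
    obtain ⟨t, ht⟩ := (hmem _).mp (hinert.mem_of_pow_mem 2 h1)
    have h2 : (4 : ℤ) ∣ 2 * k := by
      apply hintegral _ _ (by norm_num)
      refine ⟨t ^ 2, ?_⟩
      rw [← hd, ht]; push_cast; ring
    have h3 : IsUnit (2 : ℤ) := hsf 2 (by simpa using h2)
    rw [Int.isUnit_iff] at h3
    omega
  have h1 : (s + 1) ^ 2 ∈ Ideal.span {(2 : 𝓞 K)} := by
    obtain ⟨k, hk⟩ : ∃ k, d = 2 * k + 1 := ⟨d / 2, by omega⟩
    rw [hmem]
    refine ⟨k + 1 + s, ?_⟩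
    have : (d : 𝓞 K) = 2 * k + 1 := by rw [hk]; push_cast; ring
    linear_combination hd + this
  obtain ⟨y, hy⟩ := (hmem _).mp (hinert.mem_of_pow_mem 2 h1)
  have hyd : 4 * (y ^ 2 - y) = (d : 𝓞 K) - 1 := by
    have : s = 2 * y - 1 := by linear_combination hy
    rw [← hd, this]; ring
  have hd4 : (4 : ℤ) ∣ d - 1 := by
    apply hintegral _ _ (by norm_num)
    refine ⟨y ^ 2 - y, ?_⟩
    push_cast; exact hyd.symm
  by_contra hne
  obtain ⟨k, hk⟩ : ∃ k, d = 8 * k + 1 := ⟨d / 8, by omega⟩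
  have hy2 : y * (y - 1) = 2 * k := by
    have h4 : (4 : 𝓞 K) ≠ 0 := by norm_num
    apply mul_left_cancel₀ h4
    have : (d : 𝓞 K) = 8 * k + 1 := by rw [hk]; push_cast; ring
    linear_combination hyd + this
  have hσy : σ • y = 1 - y := by
    have h2 : (2 : 𝓞 K) ≠ 0 := by norm_num
    apply mul_left_cancel₀ h2
    have h3 := congrArg (fun x => σ • x) hy
    simp only [smul_add, smul_mul', hs, smul_one] at h3
    have h5 : σ • (2 : 𝓞 K) = 2 := by
      rw [← one_add_one_eq_two, smul_add, smul_one]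
    rw [h5] at h3
    linear_combination -h3 - hy
  have hσm : ∀ x : 𝓞 K, 2 ∣ x → 2 ∣ σ • x := by
    rintro x ⟨z, rfl⟩
    have h5 : σ • (2 : 𝓞 K) = 2 := by
      rw [← one_add_one_eq_two, smul_add, smul_one]
    rw [smul_mul', h5]
    exact dvd_mul_right _ _
  apply hinert.ne_top
  rw [Ideal.eq_top_iff_one, hmem]
  have h6 : y * (y - 1) ∈ Ideal.span {(2 : 𝓞 K)} := by
    rw [hmem, hy2]; exact dvd_mul_right _ _
  rcases hinert.mem_or_mem h6 with h | h <;> rw [hmem] at h <;> have h' := hσm _ h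
  · rw [hσy] at h'
    simpa using dvd_add h h'
  · rw [smul_sub, hσy, smul_one] at h'
    have := dvd_add h h'
    rw [show y - 1 + (1 - y - 1) = -1 by ring] at this
    simpa using this

lemma gw_exists (K : Type*) [Field K] [NumberField K] [IsGalois ℚ K]
    (σ : K ≃ₐ[ℚ] K) (hσ : ∀ g : K ≃ₐ[ℚ] K, g ∈ Subgroup.zpowers σ) (hσ8 : orderOf σ = 8) :
    ∃ (s : 𝓞 K) (d : ℤ), σ • s = -s ∧ s ^ 2 = (d : 𝓞 K) ∧ Squarefree d := by
  obtain ⟨x, hx0, hx⟩ : ∃ x : K, x ≠ 0 ∧ σ x = -x := by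
    have hli : LinearIndependent K (fun i : Fin 8 => (((σ ^ (i : ℕ) : K ≃ₐ[ℚ] K) : K →* K) : K → K)) := by
      refine (linearIndependent_monoidHom K K).comp
        (fun i : Fin 8 => ((σ ^ (i : ℕ) : K ≃ₐ[ℚ] K) : K →* K)) ?_
      intro i j hij
      have h1 : σ ^ (i : ℕ) = σ ^ (j : ℕ) := by
        ext x; exact DFunLike.congr_fun hij x
      exact Fin.ext (pow_injOn_Iio_orderOf (by simp [hσ8]) (by simp [hσ8]) h1)
    rw [Fintype.linearIndependent_iff] at hli
    have h2 : ∑ i : Fin 8, ((-1 : K) ^ (i : ℕ)) • (((σ ^ (i : ℕ) : K ≃ₐ[ℚ] K) : K →* K) : K → K) ≠ 0 := by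
      intro h
      have := hli _ h 0
      simp at this
    obtain ⟨y, hy⟩ := Function.ne_iff.mp h2
    refine ⟨_, hy, ?_⟩
    have h8 : ∀ z, σ (σ (σ (σ (σ (σ (σ (σ z))))))) = z := by
      intro z
      have : (σ ^ 8) z = z := by rw [← hσ8, pow_orderOf_eq_one]; rfl
      simpa [pow_succ] using this
    simp [Fin.sum_univ_succ, pow_succ, h8]
    ring
  have hfix : ∀ g : K ≃ₐ[ℚ] K, g (x ^ 2) = x ^ 2 := by
    intro g
    obtain ⟨k, rfl⟩ := (mem_powers_iff_mem_zpowers (x := σ) (y := g)).mpr (hσ g)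
    induction k with
    | zero => simp
    | succ k ih =>
      simp only at ih ⊢
      rw [pow_succ, AlgEquiv.mul_apply, map_pow, hx, neg_sq, ih]
  obtain ⟨r, hr⟩ := (IsGalois.mem_range_algebraMap_iff_fixed (F := ℚ) (x ^ 2)).mpr hfix
  have hr0 : r ≠ 0 := by
    rintro rfl
    simp at hr
    exact hx0 (by simpa using hr.symm)
  obtain ⟨d, t, ht0, hrt, hsf⟩ : ∃ (d : ℤ) (t : ℚ), t ≠ 0 ∧ r * t ^ 2 = d ∧ Squarefree d := by
    have hn : r.num * r.den ≠ 0 := by simp [hr0]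
    obtain ⟨a, b, hab, ha⟩ := Nat.sq_mul_squarefree (r.num * r.den).natAbs
    have hb : b ≠ 0 := by
      rintro rfl
      apply hn
      rw [← Int.natAbs_eq_zero, ← hab]; simp
    have hb' : (b : ℚ) ≠ 0 := by exact_mod_cast hb
    have hden : (r.den : ℚ) ≠ 0 := by exact_mod_cast r.den_nz
    refine ⟨(r.num * r.den).sign * a, r.den / b, div_ne_zero hden hb', ?_, ?_⟩
    · have h1 := Int.sign_mul_natAbs (r.num * r.den)
      rw [← hab] at h1
      have h2 : ((r.num * r.den).sign : ℚ) * ((b : ℚ) ^ 2 * a) = r.num * r.den := by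
        exact_mod_cast h1
      have h3 : r * r.den = r.num := Rat.mul_den_eq_num r
      push_cast
      field_simp
      rw [← h3] at h2
      linear_combination -h2
    · rw [← Int.squarefree_natAbs, Int.natAbs_mul, Int.natAbs_sign_of_ne_zero hn]
      simpa using ha
  have hxt : (x * algebraMap ℚ K t) ^ 2 = (d : K) := by
    rw [mul_pow, ← hr, ← map_pow, ← map_mul, hrt, map_intCast]
  have hintegral : IsIntegral ℤ (x * algebraMap ℚ K t) := by
    apply IsIntegral.of_pow (n := 2) (by norm_num)
    rw [hxt]
    exact isIntegral_intCast d
  obtain ⟨s, hs⟩ : ∃ s : 𝓞 K, algebraMap (𝓞 K) K s = x * algebraMap ℚ K t :=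
    ⟨⟨_, hintegral⟩, rfl⟩
  have hinj : Function.Injective (algebraMap (𝓞 K) K) := RingOfIntegers.coe_injective
  refine ⟨s, d, ?_, ?_, hsf⟩
  · apply hinj
    change σ (algebraMap (𝓞 K) K s) = algebraMap (𝓞 K) K (-s)
    rw [map_neg, hs, map_mul, hx, AlgEquiv.commutes]; ring
  · apply hinj
    rw [map_pow, hs, map_intCast, hxt]

lemma gw_nat (n : ℕ) (h : ∀ p : ℕ, p.Prime → p ∣ n → p % 8 = 1) (hn : n ≠ 0) : n % 8 = 1 := by
  induction n using Nat.recOnMul with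
  | zero => simp at hn
  | one => rfl
  | prime p hp => exact h p hp dvd_rfl
  | mul a b ha hb =>
    have h1 := ha (fun p hp hd => h p hp (hd.mul_right _)) (by rintro rfl; simp at hn)
    have h2 := hb (fun p hp hd => h p hp (hd.mul_left _)) (by rintro rfl; simp at hn)
    rw [Nat.mul_mod, h1, h2]

/- Grunwald–Wang: there is no number field `K`, Galois over `ℚ` with cyclic Galois
group of order `8`, in which the prime `2` is inert (i.e. such that `2·𝒪_K` is a
prime ideal of the ring of integers of `K`). -/
theorem no_cyclic_octic_field_with_two_inert (K : Type*) [Field K] [NumberField K]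
    [IsGalois ℚ K] (hcyc : IsCyclic (K ≃ₐ[ℚ] K)) (hcard : Nat.card (K ≃ₐ[ℚ] K) = 8)
    (hinert : (Ideal.span {(2 : NumberField.RingOfIntegers K)}).IsPrime) : False := by
  obtain ⟨σ, hσ⟩ := hcyc.exists_generator
  have hσ8 : orderOf σ = 8 := by
    rw [← hcard]; exact orderOf_eq_card_of_forall_mem_zpowers hσ
  obtain ⟨s, d, hs, hd, hsf⟩ := gw_exists K σ hσ hσ8
  have hd5 := gw_two K σ hinert s hs d hd hsf
  have hd1 : d.natAbs % 8 = 1 := by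
    apply gw_nat
    · intro p hp hpd
      have hpd' : (p : ℤ) ∣ d := Int.natCast_dvd.mpr hpd
      refine gw_prime_mod K σ hσ hcard s hs d hd hsf p hp ?_ hpd'
      rintro rfl
      push_cast at hpd'
      omega
    · simpa using hsf.ne_zero
  omega
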